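/- There exists a class of languages learnable by a Gold-style monotone explanatory learner that is not learnable by any partially set-driven monotone behaviourally correct learner: [TxtGMonEx] \ [TxtPsdMonBc] ≠ ∅. -/

import Mathlib

/-- The `e`-th computably enumerable set: the domain of the `e`-th partial
computable function in the standard numbering of `Nat.Partrec.Code`. -/
def Wset (e : ℕ) : Set ℕ := {x | ((Denumerable.ofNat Nat.Partrec.Code e).eval x).Dom}

/-- A text: a function from ℕ to ℕ ∪ {#}, with `none` playing the role of the pause symbol #. -/
def Text := ℕ → Option ℕ

/-- The content of a text: its range without the pause symbol. -/
def content (T : Text) : Set ℕ := {x | ∃ n, T n = some x}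

/-- The initial segment `T[n]` of a text, as a finite sequence over ℕ ∪ {#}. -/
def seg (T : Text) (n : ℕ) : List (Option ℕ) := (List.range n).map T

/-- The content of a finite sequence over ℕ ∪ {#}. -/
def contentSeg (l : List (Option ℕ)) : Set ℕ := {x | (some x) ∈ l}

/-- The content of `T[n]` as a finite set. -/
def fset (T : Text) (n : ℕ) : Finset ℕ := ((List.range n).map T).reduceOption.toFinset

/-- [TxtGMonEx]: classes learnable by some partial computable Gold-style learner which is
monotone and explanatory on texts of the learned languages. -/
def TxtGMonEx : Set (Set (Set ℕ)) :=
  {𝓛 | ∃ h : List (Option ℕ) →. ℕ, Partrec h ∧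
    ∀ L ∈ 𝓛, ∀ T : Text, content T = L →
      (∃ e : ℕ, Wset e = L ∧ ∃ n₀ : ℕ, ∀ n ≥ n₀, h (seg T n) = Part.some e) ∧
      (∀ i j : ℕ, i ≤ j → ∀ a ∈ h (seg T i), ∀ b ∈ h (seg T j),
        Wset a ∩ content T ⊆ Wset b ∩ content T)}

/-- [TxtPsdMonBc]: classes learnable by some partial computable partially set-driven
learner which is monotone and behaviourally correct on texts of the learned languages. -/
def TxtPsdMonBc : Set (Set (Set ℕ)) :=
  {𝓛 | ∃ h : Finset ℕ × ℕ →. ℕ, Partrec h ∧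
    ∀ L ∈ 𝓛, ∀ T : Text, content T = L →
      (∃ n₀ : ℕ, ∀ n ≥ n₀, ∃ e ∈ h (fset T n, n), Wset e = L) ∧
      (∀ i j : ℕ, i ≤ j → ∀ a ∈ h (fset T i, i), ∀ b ∈ h (fset T j, j),
        Wset a ∩ content T ⊆ Wset b ∩ content T)}

open Nat.Partrec (Code)

theorem exists_computable_index {α : Type*} [Primcodable α] {p : α × ℕ → Prop} (hp : REPred p) :
    ∃ s : α → ℕ, Computable s ∧ ∀ a, Wset (s a) = {x | p (a, x)} := by
  have hp' : Partrec fun q : α × ℕ => Part.assert (p q) fun _ => Part.some () := hp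
  have hg : Nat.Partrec fun n : ℕ => ((Encodable.decode n.unpair.1 : Option α) : Part α).bind
      fun a => (Part.assert (p (a, n.unpair.2)) fun _ => Part.some ()).map fun _ => 0 := by
    refine Partrec.nat_iff.1 (Partrec.bind (Computable.ofOption (Computable.decode.comp
      (Computable.fst.comp Computable.unpair))) (Partrec.map (hp'.comp ?_)
        (Computable.const 0).to₂))
    exact Computable.snd.pair (Computable.snd.comp (Computable.unpair.comp Computable.fst))
  obtain ⟨c, hc⟩ := Code.exists_code.1 hg
  refine ⟨fun a => Encodable.encode (c.curry (Encodable.encode a)), ?_, fun a => ?_⟩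
  · exact Computable.encode.comp (Code.primrec₂_curry.to_comp.comp (Computable.const c)
      Computable.encode)
  · ext x
    simp [Wset, Code.eval_curry, hc, Part.assert]

theorem exists_partrec_selector {α σ : Type*} [Primcodable α] [Primcodable σ] {g : α × ℕ →. σ}
    (hg : Partrec g) :
    ∃ f : α →. ℕ, Partrec f ∧ (∀ a n, (g (a, n)).Dom → (f a).Dom) ∧
      ∀ a, ∀ n ∈ f a, (g (a, n)).Dom := by
  obtain ⟨c, hc⟩ := Code.exists_code.1 hg
  have hdom (p : α × ℕ) : (c.eval (Encodable.encode p)).Dom ↔ (g p).Dom := by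
    simp [hc]
  let φ : α → ℕ → Option ℕ := fun a m =>
    (Code.evaln m.unpair.2 c (Encodable.encode (a, m.unpair.1))).map fun _ => m.unpair.1
  have hφ : Computable₂ φ := by
    have hu : Primrec fun q : α × ℕ => q.2.unpair := Primrec.unpair.comp Primrec.snd
    refine (Primrec.option_map (Code.primrec_evaln.comp (Primrec.pair (Primrec.pair
      (Primrec.snd.comp hu) (Primrec.const c)) (Primrec.encode.comp (Primrec.pair Primrec.fst
      (Primrec.fst.comp hu))))) ((Primrec.fst.comp hu).comp Primrec.fst).to₂).to_comp
  refine ⟨fun a => Nat.rfindOpt (φ a), Partrec.rfindOpt hφ, fun a n h => ?_, fun a n h => ?_⟩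
  · obtain ⟨y, hy⟩ := Part.dom_iff_mem.1 ((hdom (a, n)).2 h)
    obtain ⟨k, hk⟩ := Code.evaln_complete.1 hy
    refine Nat.rfindOpt_dom.2 ⟨Nat.pair n k, n, ?_⟩
    simp only [φ, Nat.unpair_pair]
    exact Option.mem_map.2 ⟨y, hk, rfl⟩
  · obtain ⟨m, hm⟩ := Nat.rfindOpt_spec h
    obtain ⟨y, hy, rfl⟩ := Option.mem_map.1 hm
    exact (hdom _).1 (Part.dom_iff_mem.2 ⟨y, Code.evaln_sound hy⟩)

theorem lower'_map_range' (a : ℕ → ℕ) (n s : ℕ) :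
    Denumerable.lower' ((List.range' s n).map a) (Nat.casesOn s 0 fun k => a k + 1) =
      (List.range' s n).map fun k => a k - Nat.casesOn k 0 fun k => a k + 1 := by
  induction n generalizing s with
  | zero => rfl
  | succ n ih => simpa [List.range'_succ, Denumerable.lower'] using ih (s + 1)

theorem sort_image_range {a : ℕ → ℕ} (ha : StrictMono a) (n : ℕ) :
    ((Finset.range n).image a).sort = (List.range n).map a := by
  have h : (Finset.range n).image a = ((List.range n).map a).toFinset := by
    ext x
    simp
  rw [h, List.toFinset_sort _ (List.nodup_range.map ha.injective), List.pairwise_map]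
  exact List.pairwise_lt_range.imp fun hxy => (ha hxy).le

theorem primrec_image_range {α : Type*} [Primcodable α] {a : α → ℕ → ℕ} {m : α → ℕ}
    (ha : Primrec₂ a) (hm : Primrec m) (hmono : ∀ p, StrictMono (a p)) :
    Primrec fun p => (Finset.range (m p)).image (a p) := by
  have henc (p : α) : Primcodable.toEncodable.encode ((Finset.range (m p)).image (a p)) =
      Encodable.encode
        ((List.range (m p)).map fun k => a p k - Nat.casesOn k 0 fun k => a p k + 1) := by
    have hmap : ((Finset.range (m p)).image (a p)).map (Denumerable.eqv ℕ).toEmbedding =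
        (Finset.range (m p)).image (a p) := by
      ext x
      simp [Denumerable.eqv]
    change Encodable.encode (Denumerable.lower'
      (((Finset.range (m p)).image (a p)).map (Denumerable.eqv ℕ).toEmbedding).sort 0) = _
    rw [hmap, sort_image_range (hmono p), List.range_eq_range']
    exact congrArg _ (lower'_map_range' (a p) (m p) 0)
  refine Primrec.encode_iff.1 (Primrec.of_eq ?_ fun p => (henc p).symm)
  exact Primrec.encode.comp (Primrec.list_map (Primrec.list_range.comp hm)
    (Primrec.nat_sub.comp (ha.comp Primrec.fst Primrec.snd)
      (Primrec.nat_casesOn Primrec.snd (Primrec.const 0)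
      (Primrec.succ.comp (ha.comp (Primrec.fst.comp Primrec.fst) Primrec.snd)).to₂)).to₂)

/-- The natural number coding the triple `(c, j, i)`. -/
def triple (c j i : ℕ) : ℕ := Nat.pair c (Nat.pair j i)

/-- The first component of a coded triple. -/
def learnerTag (x : ℕ) : ℕ := x.unpair.1

/-- The second component of a coded triple. -/
def blockIndex (x : ℕ) : ℕ := x.unpair.2.unpair.1

/-- The third component of a coded triple. -/
def position (x : ℕ) : ℕ := x.unpair.2.unpair.2

@[simp] theorem learnerTag_triple (c j i : ℕ) : learnerTag (triple c j i) = c := by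
  simp [learnerTag, triple]

@[simp] theorem blockIndex_triple (c j i : ℕ) : blockIndex (triple c j i) = j := by
  simp [blockIndex, triple]

@[simp] theorem position_triple (c j i : ℕ) : position (triple c j i) = i := by
  simp [position, triple]

@[simp] theorem triple_eta (x : ℕ) : triple (learnerTag x) (blockIndex x) (position x) = x := by
  simp [triple, learnerTag, blockIndex, position]

theorem primrec_learnerTag : Primrec learnerTag := Primrec.fst.comp Primrec.unpair

theorem primrec_blockIndex : Primrec blockIndex :=
  Primrec.fst.comp (Primrec.unpair.comp (Primrec.snd.comp Primrec.unpair))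

theorem primrec_position : Primrec position :=
  Primrec.snd.comp (Primrec.unpair.comp (Primrec.snd.comp Primrec.unpair))

theorem strictMono_triple (c j : ℕ) : StrictMono (triple c j) :=
  fun _ _ h => Nat.pair_lt_pair_right _ (Nat.pair_lt_pair_right _ h)

/-- All elements of block `j` with tag `c`. -/
def fullBlock (c j : ℕ) : Set ℕ := {x | learnerTag x = c ∧ blockIndex x = j}

/-- The union over all `j` of the initial parts of length `F (c, j)` of the blocks `(c, j)`. -/
def cutBlocks (F : ℕ × ℕ →. ℕ) (c : ℕ) : Set ℕ :=
  {x | learnerTag x = c ∧ ∃ v ∈ F (c, blockIndex x), position x < v}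

/-- The union over `j ≤ k` of the initial parts of length `F (c, j)` of the blocks `(c, j)`,
together with the marker at position `F (c, k)` of block `k`. -/
def markedBlocks (F : ℕ × ℕ →. ℕ) (c k : ℕ) : Set ℕ :=
  {x | learnerTag x = c ∧ ∃ v ∈ F (c, blockIndex x),
    blockIndex x < k ∧ position x < v ∨ blockIndex x = k ∧ position x ≤ v}

/-- The class of all full blocks together with, for the tags on which `F` is total, the cut blocks
and the marked blocks. -/
def blockClass (F : ℕ × ℕ →. ℕ) : Set (Set ℕ) :=
  {L | (∃ c j, L = fullBlock c j) ∨
    ∃ c, (∀ j, (F (c, j)).Dom) ∧ (L = cutBlocks F c ∨ ∃ k > 0, L = markedBlocks F c k)}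

theorem rePred_fullBlock : REPred fun q : (ℕ × ℕ) × ℕ => q.2 ∈ fullBlock q.1.1 q.1.2 := by
  refine ComputablePred.to_re (PrimrecPred.computablePred (PrimrecPred.and ?_ ?_))
  · exact Primrec.eq.comp (primrec_learnerTag.comp Primrec.snd) (Primrec.fst.comp Primrec.fst)
  · exact Primrec.eq.comp (primrec_blockIndex.comp Primrec.snd) (Primrec.snd.comp Primrec.fst)

theorem REPred.exists_mem_partrec {α σ : Type*} [Primcodable α] [Primcodable σ] {g : α →. σ}
    (hg : Partrec g) {p : α → σ → Prop} (hp : PrimrecRel p) : REPred fun a => ∃ v ∈ g a, p a v := by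
  classical
  have hp' : Computable fun q : α × σ => if p q.1 q.2 then some () else none :=
    (Primrec.ite (show PrimrecPred fun q : α × σ => p q.1 q.2 from hp)
      (Primrec.const (some ())) (Primrec.const none)).to_comp
  refine (Partrec.dom_re (hg.bind (Computable.ofOption hp').to₂)).of_eq fun a => ?_
  rw [Part.dom_iff_mem]
  simp

theorem rePred_cutBlocks {F : ℕ × ℕ →. ℕ} (hF : Partrec F) :
    REPred fun q : ℕ × ℕ => q.2 ∈ cutBlocks F q.1 := by
  have hp : PrimrecRel fun (q : ℕ × ℕ) (v : ℕ) => learnerTag q.2 = q.1 ∧ position q.2 < v :=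
    PrimrecPred.and
      (Primrec.eq.comp (primrec_learnerTag.comp (Primrec.snd.comp Primrec.fst))
        (Primrec.fst.comp Primrec.fst))
      (Primrec.nat_lt.comp (primrec_position.comp (Primrec.snd.comp Primrec.fst)) Primrec.snd)
  refine (REPred.exists_mem_partrec (hF.comp (Computable.pair Computable.fst
    (primrec_blockIndex.to_comp.comp Computable.snd))) hp).of_eq fun q => ?_
  exact ⟨fun ⟨v, hv, h₁, h₂⟩ => ⟨h₁, v, hv, h₂⟩, fun ⟨h₁, v, hv, h₂⟩ => ⟨v, hv, h₁, h₂⟩⟩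

theorem rePred_markedBlocks {F : ℕ × ℕ →. ℕ} (hF : Partrec F) :
    REPred fun q : (ℕ × ℕ) × ℕ => q.2 ∈ markedBlocks F q.1.1 q.1.2 := by
  have hx : Primrec fun r : ((ℕ × ℕ) × ℕ) × ℕ => r.1.2 := Primrec.snd.comp Primrec.fst
  have hc : Primrec fun r : ((ℕ × ℕ) × ℕ) × ℕ => r.1.1.1 :=
    Primrec.fst.comp (Primrec.fst.comp Primrec.fst)
  have hk : Primrec fun r : ((ℕ × ℕ) × ℕ) × ℕ => r.1.1.2 :=
    Primrec.snd.comp (Primrec.fst.comp Primrec.fst)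
  have hp : PrimrecRel fun (q : (ℕ × ℕ) × ℕ) (v : ℕ) => learnerTag q.2 = q.1.1 ∧
      (blockIndex q.2 < q.1.2 ∧ position q.2 < v ∨ blockIndex q.2 = q.1.2 ∧ position q.2 ≤ v) :=
    PrimrecPred.and (Primrec.eq.comp (primrec_learnerTag.comp hx) hc)
      (PrimrecPred.or
        (PrimrecPred.and (Primrec.nat_lt.comp (primrec_blockIndex.comp hx) hk)
          (Primrec.nat_lt.comp (primrec_position.comp hx) Primrec.snd))
        (PrimrecPred.and (Primrec.eq.comp (primrec_blockIndex.comp hx) hk)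
          (Primrec.nat_le.comp (primrec_position.comp hx) Primrec.snd)))
  refine (REPred.exists_mem_partrec (hF.comp (Computable.pair
    (Computable.fst.comp Computable.fst)
    (primrec_blockIndex.to_comp.comp Computable.snd))) hp).of_eq fun q => ?_
  exact ⟨fun ⟨v, hv, h₁, h₂⟩ => ⟨h₁, v, hv, h₂⟩, fun ⟨h₁, v, hv, h₂⟩ => ⟨v, hv, h₁, h₂⟩⟩

/-- The largest block index occurring in a list. -/
def maxBlock (l : List ℕ) : ℕ := l.foldr (fun x m => max (blockIndex x) m) 0

theorem blockIndex_le_maxBlock {l : List ℕ} {x : ℕ} (hx : x ∈ l) : blockIndex x ≤ maxBlock l := by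
  induction l with
  | nil => simp at hx
  | cons y l ih =>
    simp only [maxBlock, List.foldr_cons, List.mem_cons] at *
    rcases hx with rfl | hx
    · exact le_max_left _ _
    · exact (ih hx).trans (le_max_right _ _)

theorem exists_blockIndex_eq_maxBlock {l : List ℕ} (hl : l ≠ []) :
    ∃ x ∈ l, blockIndex x = maxBlock l := by
  induction l with
  | nil => exact absurd rfl hl
  | cons y l ih =>
    rcases eq_or_ne l [] with rfl | hl'
    · exact ⟨y, by simp, by simp [maxBlock]⟩
    · obtain ⟨x, hx, hxl⟩ := ih hl'
      have hcons : maxBlock (y :: l) = max (blockIndex y) (maxBlock l) := rfl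
      rcases le_total (blockIndex y) (maxBlock l) with h | h
      · exact ⟨x, by simp [hx], by rw [hcons, hxl, max_eq_right h]⟩
      · exact ⟨y, by simp, by rw [hcons, max_eq_left h]⟩

theorem maxBlock_mono {l l' : List ℕ} (h : l ⊆ l') : maxBlock l ≤ maxBlock l' := by
  rcases eq_or_ne l [] with rfl | hl
  · exact Nat.zero_le _
  · obtain ⟨x, hx, hxl⟩ := exists_blockIndex_eq_maxBlock hl
    exact hxl ▸ blockIndex_le_maxBlock (h hx)

theorem primrec_maxBlock : Primrec maxBlock :=
  Primrec.list_foldr Primrec.id (Primrec.const 0)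
    (Primrec.nat_max.comp (primrec_blockIndex.comp (Primrec.fst.comp Primrec.snd))
      (Primrec.snd.comp Primrec.snd)).to₂

open Classical in
/-- The order-sensitive learner: it compares the block of the first datum with all later ones. -/
noncomputable def blockLearner (F : ℕ × ℕ →. ℕ) (sFull : ℕ × ℕ → ℕ) (sCut : ℕ → ℕ)
    (sMarked : ℕ × ℕ → ℕ) (σ : List (Option ℕ)) : Part ℕ :=
  (σ.reduceOption.head? : Part ℕ).bind fun x =>
    bif decide (∃ y ∈ σ.reduceOption, blockIndex y ≠ blockIndex x) then
      (F (learnerTag x, maxBlock σ.reduceOption)).map fun v =>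
        if maxBlock σ.reduceOption = blockIndex x ∨
            ∃ y ∈ σ.reduceOption, y = triple (learnerTag x) (maxBlock σ.reduceOption) v then
          sMarked (learnerTag x, maxBlock σ.reduceOption)
        else sCut (learnerTag x)
    else Part.some (sFull (learnerTag x, blockIndex x))

theorem partrec_blockLearner {F : ℕ × ℕ →. ℕ} {sFull : ℕ × ℕ → ℕ} {sCut : ℕ → ℕ}
    {sMarked : ℕ × ℕ → ℕ} (hF : Partrec F) (hFull : Computable sFull) (hCut : Computable sCut)
    (hMarked : Computable sMarked) : Partrec (blockLearner F sFull sCut sMarked) := by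
  classical
  have hred : Primrec fun σ : List (Option ℕ) => σ.reduceOption :=
    Primrec.listFilterMap Primrec.id Primrec.snd.to₂
  have hmax : Primrec fun q : (List (Option ℕ) × ℕ) => maxBlock q.1.reduceOption :=
    primrec_maxBlock.comp (hred.comp Primrec.fst)
  have hdiff : PrimrecPred fun q : List (Option ℕ) × ℕ =>
      ∃ y ∈ q.1.reduceOption, blockIndex y ≠ blockIndex q.2 := by
    have h : PrimrecRel fun y x : ℕ => blockIndex y ≠ blockIndex x :=
      PrimrecPred.not (Primrec.eq.comp (primrec_blockIndex.comp Primrec.fst)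
        (primrec_blockIndex.comp Primrec.snd))
    exact h.exists_mem_list.comp (hred.comp Primrec.fst) Primrec.snd
  have hmark : PrimrecPred fun r : (List (Option ℕ) × ℕ) × ℕ =>
      maxBlock r.1.1.reduceOption = blockIndex r.1.2 ∨ ∃ y ∈ r.1.1.reduceOption,
        y = triple (learnerTag r.1.2) (maxBlock r.1.1.reduceOption) r.2 := by
    refine PrimrecPred.or (Primrec.eq.comp (hmax.comp Primrec.fst)
      (primrec_blockIndex.comp (Primrec.snd.comp Primrec.fst))) ?_
    exact (PrimrecRel.exists_mem_list Primrec.eq).comp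
      (hred.comp (Primrec.fst.comp Primrec.fst))
      (Primrec₂.natPair.comp (primrec_learnerTag.comp (Primrec.snd.comp Primrec.fst))
        (Primrec₂.natPair.comp (hmax.comp Primrec.fst) Primrec.snd))
  have htag : Computable fun q : List (Option ℕ) × ℕ => learnerTag q.2 :=
    primrec_learnerTag.to_comp.comp Computable.snd
  refine Partrec.bind (Computable.ofOption (Primrec.list_head?.comp hred).to_comp) ?_
  refine Partrec.cond hdiff.decide.to_comp (Partrec.map (hF.comp (htag.pair hmax.to_comp)) ?_)
    (hFull.comp (htag.pair (primrec_blockIndex.to_comp.comp Computable.snd)))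
  refine (Computable.cond hmark.decide.to_comp
    (hMarked.comp ((htag.pair hmax.to_comp).comp Computable.fst))
    (hCut.comp (htag.comp Computable.fst))).of_eq fun r => ?_
  simp

theorem mem_cutBlocks {F : ℕ × ℕ →. ℕ} {c : ℕ} {f : ℕ → ℕ} (hf : ∀ j, F (c, j) = Part.some (f j))
    {x : ℕ} : x ∈ cutBlocks F c ↔ learnerTag x = c ∧ position x < f (blockIndex x) := by
  change _ ∧ _ ↔ _
  simp [hf]

theorem mem_markedBlocks {F : ℕ × ℕ →. ℕ} {c k : ℕ} {f : ℕ → ℕ}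
    (hf : ∀ j, F (c, j) = Part.some (f j)) {x : ℕ} :
    x ∈ markedBlocks F c k ↔ learnerTag x = c ∧
      (blockIndex x < k ∧ position x < f (blockIndex x) ∨
        blockIndex x = k ∧ position x ≤ f (blockIndex x)) := by
  change _ ∧ _ ↔ _
  simp [hf]

theorem mem_fullBlock {c j x : ℕ} : x ∈ fullBlock c j ↔ learnerTag x = c ∧ blockIndex x = j :=
  Iff.rfl

open Classical in
theorem mem_blockLearner {F : ℕ × ℕ →. ℕ} {sFull : ℕ × ℕ → ℕ} {sCut : ℕ → ℕ}
    {sMarked : ℕ × ℕ → ℕ} {σ : List (Option ℕ)} {a : ℕ} :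
    a ∈ blockLearner F sFull sCut sMarked σ ↔ ∃ x, σ.reduceOption.head? = some x ∧
      ((∀ y ∈ σ.reduceOption, blockIndex y = blockIndex x) ∧
          a = sFull (learnerTag x, blockIndex x) ∨
        (∃ y ∈ σ.reduceOption, blockIndex y ≠ blockIndex x) ∧
          ∃ v ∈ F (learnerTag x, maxBlock σ.reduceOption),
            a = if maxBlock σ.reduceOption = blockIndex x ∨
              triple (learnerTag x) (maxBlock σ.reduceOption) v ∈ σ.reduceOption then
                sMarked (learnerTag x, maxBlock σ.reduceOption)
              else sCut (learnerTag x)) := by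
  simp only [blockLearner, Part.mem_bind_iff, Part.mem_ofOption, Option.mem_def]
  refine exists_congr fun x => and_congr_right fun _ => ?_
  by_cases h : ∃ y ∈ σ.reduceOption, blockIndex y ≠ blockIndex x
  · have h' : ¬ ∀ y ∈ σ.reduceOption, blockIndex y = blockIndex x := by push Not; exact h
    simp only [h, h', decide_true, cond_true, Part.mem_map_iff, false_and, true_and, false_or,
      exists_eq_right, @eq_comm _ a]
  · have h' : ∀ y ∈ σ.reduceOption, blockIndex y = blockIndex x := by push Not at h; exact h
    simp only [h, decide_false, cond_false, Part.mem_some_iff, false_and, or_false]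
    exact ⟨fun ha => ⟨h', ha⟩, fun ha => ha.2⟩

theorem mem_reduceOption_seg {T : Text} {n x : ℕ} :
    x ∈ (seg T n).reduceOption ↔ ∃ i < n, T i = some x := by
  exact List.reduceOption_mem_iff.trans (List.mem_map.trans (by simp only [List.mem_range]))

theorem prefix_reduceOption_seg (T : Text) {m n : ℕ} (h : m ≤ n) :
    (seg T m).reduceOption <+: (seg T n).reduceOption := by
  refine List.IsPrefix.filterMap _ (List.IsPrefix.map _ ?_)
  obtain ⟨k, rfl⟩ := Nat.exists_eq_add_of_le h
  exact ⟨_, (List.range_add).symm⟩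

theorem mem_content_of_mem_seg {T : Text} {n x : ℕ} (h : x ∈ (seg T n).reduceOption) :
    x ∈ content T := by
  obtain ⟨i, _, hi⟩ := mem_reduceOption_seg.1 h
  exact ⟨i, hi⟩

theorem eventually_mem_seg {T : Text} {x : ℕ} (hx : x ∈ content T) :
    ∃ n₀, ∀ n ≥ n₀, x ∈ (seg T n).reduceOption := by
  obtain ⟨i, hi⟩ := hx
  exact ⟨i + 1, fun n hn => mem_reduceOption_seg.2 ⟨i, hn, hi⟩⟩

theorem List.IsPrefix.head?_eq_some {α : Type*} {l l' : List α} (h : l <+: l') {x : α}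
    (hx : l.head? = some x) : l'.head? = some x := by
  obtain ⟨t, rfl⟩ := h
  simp [List.head?_append, hx]

theorem mem_of_head?_reduceOption_seg {T : Text} {n x : ℕ}
    (h : (seg T n).reduceOption.head? = some x) : x ∈ content T :=
  mem_content_of_mem_seg (List.mem_of_mem_head? h)

section

variable {F : ℕ × ℕ →. ℕ} {sFull : ℕ × ℕ → ℕ} {sCut : ℕ → ℕ} {sMarked : ℕ × ℕ → ℕ}

theorem blockLearner_fullBlock {c j : ℕ} {T : Text} (hT : content T = fullBlock c j) {n a : ℕ}
    (ha : a ∈ blockLearner F sFull sCut sMarked (seg T n)) : a = sFull (c, j) := by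
  have hmem (y : ℕ) (hy : y ∈ content T) : learnerTag y = c ∧ blockIndex y = j :=
    mem_fullBlock.1 (hT ▸ hy)
  obtain ⟨x, hx, ⟨_, rfl⟩ | ⟨⟨y, hy, hyx⟩, _⟩⟩ := mem_blockLearner.1 ha
  · rw [(hmem x (mem_of_head?_reduceOption_seg hx)).1, (hmem x (mem_of_head?_reduceOption_seg hx)).2]
  · rw [(hmem x (mem_of_head?_reduceOption_seg hx)).2,
      (hmem y (mem_content_of_mem_seg hy)).2] at hyx
    exact absurd rfl hyx

theorem blockLearner_fullBlock_converges {c j : ℕ} {T : Text} (hT : content T = fullBlock c j) :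
    ∃ n₀, ∀ n ≥ n₀, blockLearner F sFull sCut sMarked (seg T n) = Part.some (sFull (c, j)) := by
  have hmem (y : ℕ) (hy : y ∈ content T) : learnerTag y = c ∧ blockIndex y = j :=
    mem_fullBlock.1 (hT ▸ hy)
  obtain ⟨n₀, hn₀⟩ := eventually_mem_seg (T := T) (x := triple c j 0)
    (hT ▸ mem_fullBlock.2 ⟨by simp, by simp⟩)
  refine ⟨n₀, fun n hn => Part.eq_some_iff.2 ?_⟩
  obtain ⟨x, hx⟩ := Option.ne_none_iff_exists'.1
    (mt List.head?_eq_none_iff.1 (List.ne_nil_of_mem (hn₀ n hn)))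
  have hxT := hmem x (mem_of_head?_reduceOption_seg hx)
  exact mem_blockLearner.2 ⟨x, hx, Or.inl ⟨fun y hy =>
    (hmem y (mem_content_of_mem_seg hy)).2.trans hxT.2.symm, by rw [hxT.1, hxT.2]⟩⟩

theorem blockLearner_cutBlocks_converges {c : ℕ} {f : ℕ → ℕ}
    (hf : ∀ j, F (c, j) = Part.some (f j)) (hpos : ∀ j, 0 < f j) {T : Text}
    (hT : content T = cutBlocks F c) :
    ∃ n₀, ∀ n ≥ n₀, blockLearner F sFull sCut sMarked (seg T n) = Part.some (sCut c) := by
  have hmem (y : ℕ) (hy : y ∈ content T) : learnerTag y = c ∧ position y < f (blockIndex y) :=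
    (mem_cutBlocks hf).1 (hT ▸ hy)
  obtain ⟨n₀, hn₀⟩ := eventually_mem_seg (T := T) (x := triple c 0 0)
    (hT ▸ (mem_cutBlocks hf).2 ⟨by simp, by simpa using hpos 0⟩)
  obtain ⟨x, hx⟩ := Option.ne_none_iff_exists'.1
    (mt List.head?_eq_none_iff.1 (List.ne_nil_of_mem (hn₀ n₀ le_rfl)))
  obtain ⟨n₁, hn₁⟩ := eventually_mem_seg (T := T) (x := triple c (blockIndex x + 1) 0)
    (hT ▸ (mem_cutBlocks hf).2 ⟨by simp, by simpa using hpos _⟩)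
  refine ⟨max n₀ n₁, fun n hn => Part.eq_some_iff.2 ?_⟩
  have hxT := hmem x (mem_of_head?_reduceOption_seg hx)
  have hle := blockIndex_le_maxBlock (hn₁ n (le_trans (le_max_right _ _) hn))
  rw [blockIndex_triple] at hle
  refine mem_blockLearner.2 ⟨x, (prefix_reduceOption_seg T
    (le_trans (le_max_left _ _) hn)).head?_eq_some hx, Or.inr ⟨⟨_, hn₁ n
    (le_trans (le_max_right _ _) hn), by simp⟩, f (maxBlock (seg T n).reduceOption), ?_, ?_⟩⟩
  · rw [hxT.1, hf]
    exact Part.mem_some _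
  · rw [if_neg, hxT.1]
    rintro (h | h)
    · omega
    · simpa using (hmem _ (mem_content_of_mem_seg h)).2

theorem blockLearner_markedBlocks_converges {c k : ℕ} (hk : 0 < k) {f : ℕ → ℕ}
    (hf : ∀ j, F (c, j) = Part.some (f j)) (hpos : ∀ j, 0 < f j) {T : Text}
    (hT : content T = markedBlocks F c k) :
    ∃ n₀, ∀ n ≥ n₀, blockLearner F sFull sCut sMarked (seg T n) = Part.some (sMarked (c, k)) := by
  have hmem (y : ℕ) (hy : y ∈ content T) := (mem_markedBlocks hf).1 (hT ▸ hy)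
  obtain ⟨n₀, hn₀⟩ := eventually_mem_seg (T := T) (x := triple c 0 0)
    (hT ▸ (mem_markedBlocks hf).2 ⟨by simp, Or.inl ⟨by simpa using hk, by simpa using hpos 0⟩⟩)
  obtain ⟨n₁, hn₁⟩ := eventually_mem_seg (T := T) (x := triple c k (f k))
    (hT ▸ (mem_markedBlocks hf).2 ⟨by simp, Or.inr ⟨by simp, by simp⟩⟩)
  refine ⟨max n₀ n₁, fun n hn => Part.eq_some_iff.2 ?_⟩
  have h₀ := hn₀ n (le_trans (le_max_left _ _) hn)
  have h₁ := hn₁ n (le_trans (le_max_right _ _) hn)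
  obtain ⟨x, hx⟩ := Option.ne_none_iff_exists'.1
    (mt List.head?_eq_none_iff.1 (List.ne_nil_of_mem h₀))
  have hxT := hmem x (mem_of_head?_reduceOption_seg hx)
  have hmax : maxBlock (seg T n).reduceOption = k := by
    refine le_antisymm ?_ (by simpa using blockIndex_le_maxBlock h₁)
    obtain ⟨y, hy, hyk⟩ := exists_blockIndex_eq_maxBlock (List.ne_nil_of_mem h₀)
    have := hmem y (mem_content_of_mem_seg hy)
    omega
  refine mem_blockLearner.2 ⟨x, hx, Or.inr ⟨?_, f k, ?_, ?_⟩⟩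
  · rcases eq_or_ne (blockIndex x) 0 with h | h
    · exact ⟨_, h₁, by simpa [h] using hk.ne'⟩
    · exact ⟨_, h₀, by simpa using h.symm⟩
  · rw [hxT.1, hmax, hf]
    exact Part.mem_some _
  · rw [if_pos, hxT.1, hmax]
    rw [hxT.1, hmax]
    exact Or.inr h₁

theorem blockLearner_monotone (hFull : ∀ p : ℕ × ℕ, Wset (sFull p) = fullBlock p.1 p.2)
    (hCut : ∀ c, Wset (sCut c) = cutBlocks F c)
    (hMarked : ∀ p : ℕ × ℕ, Wset (sMarked p) = markedBlocks F p.1 p.2) {c : ℕ} {f : ℕ → ℕ}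
    (hf : ∀ j, F (c, j) = Part.some (f j)) {T : Text}
    (hT : content T = cutBlocks F c ∨ ∃ k, content T = markedBlocks F c k) {i j : ℕ} (hij : i ≤ j)
    {a b : ℕ} (ha : a ∈ blockLearner F sFull sCut sMarked (seg T i))
    (hb : b ∈ blockLearner F sFull sCut sMarked (seg T j)) :
    Wset a ∩ content T ⊆ Wset b ∩ content T := by
  classical
  rintro z ⟨hza, hzT⟩
  refine ⟨?_, hzT⟩
  have hpre := prefix_reduceOption_seg T hij
  obtain ⟨x, hx, ha⟩ := mem_blockLearner.1 ha
  obtain ⟨x', hx', hb⟩ := mem_blockLearner.1 hb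
  obtain rfl : x = x' := by simpa [hx'] using (hpre.head?_eq_some hx).symm
  have hmax := maxBlock_mono hpre.subset
  obtain ⟨y, hy, hyi⟩ := exists_blockIndex_eq_maxBlock
    (List.ne_nil_of_mem (List.mem_of_mem_head? hx))
  obtain ⟨y', hy', hyj⟩ := exists_blockIndex_eq_maxBlock
    (List.ne_nil_of_mem (List.mem_of_mem_head? hx'))
  have hxi := blockIndex_le_maxBlock (List.mem_of_mem_head? hx)
  have hsub (w : ℕ) (hw : w ∈ (seg T i).reduceOption) : w ∈ (seg T j).reduceOption :=
    hpre.subset hw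
  have hcont (w : ℕ) (hw : w ∈ (seg T j).reduceOption) : w ∈ content T :=
    mem_content_of_mem_seg hw
  have hxc : learnerTag x = c := by
    have := hcont x (List.mem_of_mem_head? hx')
    rcases hT with hT | ⟨k, hT⟩
    · exact ((mem_cutBlocks hf).1 (hT ▸ this)).1
    · exact ((mem_markedBlocks hf).1 (hT ▸ this)).1
  have hzc : learnerTag z = c := by
    rcases hT with hT | ⟨k, hT⟩
    · exact ((mem_cutBlocks hf).1 (hT ▸ hzT)).1
    · exact ((mem_markedBlocks hf).1 (hT ▸ hzT)).1
  have hbound (w : ℕ) (hw : w ∈ content T) : position w ≤ f (blockIndex w) := by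
    rcases hT with hT | ⟨k, hT⟩
    · exact ((mem_cutBlocks hf).1 (hT ▸ hw)).2.le
    · have := ((mem_markedBlocks hf).1 (hT ▸ hw)).2
      omega
  have hlast (w : ℕ) (hw : w ∈ content T) (h : position w = f (blockIndex w)) :
      ∀ w' ∈ content T, blockIndex w' ≤ blockIndex w := by
    intro w' hw'
    rcases hT with hT | ⟨k, hT⟩
    · have := ((mem_cutBlocks hf).1 (hT ▸ hw)).2
      omega
    · have := ((mem_markedBlocks hf).1 (hT ▸ hw)).2
      have := ((mem_markedBlocks hf).1 (hT ▸ hw')).2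
      omega
  have hzx (hz : position z = f (blockIndex z)) :
      maxBlock (seg T j).reduceOption ≤ blockIndex z := hyj ▸ hlast z hzT hz y' (hcont y' hy')
  have hzpos := hbound z hzT
  rcases hb with ⟨hsame, rfl⟩ | ⟨-, v', hv', rfl⟩
  · rcases ha with ⟨-, rfl⟩ | ⟨⟨w, hw, hwx⟩, -⟩
    · exact hza
    · exact absurd (hsame w (hsub w hw)) hwx
  rw [hxc, hf, Part.mem_some_iff] at hv'
  subst hv'
  by_cases hm' : maxBlock (seg T j).reduceOption = blockIndex x
  · have hm : maxBlock (seg T i).reduceOption = blockIndex x := by omega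
    rw [if_pos (Or.inl hm'), hMarked, hxc, mem_markedBlocks hf]
    refine ⟨hzc, ?_⟩
    rcases ha with ⟨-, rfl⟩ | ⟨-, v, -, rfl⟩
    · rw [hFull, mem_fullBlock] at hza
      dsimp only at hza
      omega
    · rw [if_pos (Or.inl hm), hMarked, hxc, mem_markedBlocks hf] at hza
      dsimp only at hza ⊢
      omega
  by_cases hmark : triple (learnerTag x) (maxBlock (seg T j).reduceOption)
      (f (maxBlock (seg T j).reduceOption)) ∈ (seg T j).reduceOption
  · rw [if_pos (Or.inr hmark), hMarked, hxc, mem_markedBlocks hf]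
    have := hlast _ (hcont _ hmark) (by simp) z hzT
    rw [blockIndex_triple] at this
    dsimp only
    omega
  · rw [if_neg (by tauto), hCut, hxc, mem_cutBlocks hf]
    refine ⟨hzc, lt_of_le_of_ne hzpos fun hz => ?_⟩
    have := hzx hz
    rcases ha with ⟨-, rfl⟩ | ⟨-, v, hv, rfl⟩
    · rw [hFull, mem_fullBlock] at hza
      dsimp only at hza
      have := blockIndex_le_maxBlock (List.mem_of_mem_head? hx')
      omega
    rw [hxc, hf, Part.mem_some_iff] at hv
    subst hv
    split_ifs at hza with hm
    · rw [hMarked, hxc, mem_markedBlocks hf] at hza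
      dsimp only at hza
      have hmm : maxBlock (seg T i).reduceOption = maxBlock (seg T j).reduceOption := by omega
      rcases hm with hm | hm
      · omega
      · exact hmark (hmm ▸ hsub _ hm)
    · rw [hCut, hxc, mem_cutBlocks hf] at hza
      omega

end

theorem blockClass_mem_TxtGMonEx {F : ℕ × ℕ →. ℕ} (hF : Partrec F)
    (hpos : ∀ p, ∀ v ∈ F p, 0 < v) : blockClass F ∈ TxtGMonEx := by
  obtain ⟨sFull, cFull, hFull⟩ := exists_computable_index rePred_fullBlock
  obtain ⟨sCut, cCut, hCut⟩ := exists_computable_index (rePred_cutBlocks hF)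
  obtain ⟨sMarked, cMarked, hMarked⟩ := exists_computable_index (rePred_markedBlocks hF)
  refine ⟨blockLearner F sFull sCut sMarked, partrec_blockLearner hF cFull cCut cMarked, ?_⟩
  rintro L (⟨c, j, rfl⟩ | ⟨c, htot, hL⟩) T hT
  · refine ⟨⟨_, hFull (c, j), blockLearner_fullBlock_converges hT⟩, fun i i' _ a ha b hb => ?_⟩
    rw [blockLearner_fullBlock hT ha, blockLearner_fullBlock hT hb]
  · have hf (j : ℕ) : F (c, j) = Part.some ((F (c, j)).get (htot j)) := (Part.some_get _).symm
    have hfpos (j : ℕ) : 0 < (F (c, j)).get (htot j) := hpos _ _ (Part.get_mem _)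
    refine ⟨?_, fun i j hij a ha b hb => ?_⟩
    · rcases hL with rfl | ⟨k, hk, rfl⟩
      · exact ⟨_, hCut c, blockLearner_cutBlocks_converges hf hfpos hT⟩
      · exact ⟨_, hMarked (c, k), blockLearner_markedBlocks_converges hk hf hfpos hT⟩
    · refine blockLearner_monotone hFull hCut hMarked hf ?_ hij ha hb
      rcases hL with rfl | ⟨k, -, rfl⟩
      · exact Or.inl hT
      · exact Or.inr ⟨k, hT⟩

theorem exists_code_eval_encode {α : Type*} [Primcodable α] {h : α →. ℕ} (hh : Partrec h) :
    ∃ c : Code, ∀ a, c.eval (Encodable.encode a) = h a := by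
  obtain ⟨c, hc⟩ := Code.exists_code.1 hh
  refine ⟨c, fun a => ?_⟩
  rw [hc]
  simp [Part.map_id']

/-- On the canonical text of the block `(c, j)`, the partially set-driven learner `h` overgeneralizes
at time `v`. -/
def Overgeneralizes (h : Finset ℕ × ℕ →. ℕ) (c j v : ℕ) : Prop :=
  ∃ e ∈ h ((Finset.range v).image (triple c j), v), triple c j v ∈ Wset e

theorem exists_partrec_overgeneralization :
    ∃ F : ℕ × ℕ →. ℕ, Partrec F ∧ (∀ p, ∀ v ∈ F p, 0 < v) ∧
      ∀ h : Finset ℕ × ℕ →. ℕ, Partrec h → ∃ c, ∀ j,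
        ((∃ v > 0, Overgeneralizes h c j v) → (F (c, j)).Dom) ∧
          ∀ v ∈ F (c, j), Overgeneralizes h c j v := by
  have htriple : Primrec₂ fun (q : (ℕ × ℕ) × ℕ) (i : ℕ) => triple q.1.1 q.1.2 i :=
    Primrec₂.natPair.comp (Primrec.fst.comp (Primrec.fst.comp Primrec.fst))
      (Primrec₂.natPair.comp (Primrec.snd.comp (Primrec.fst.comp Primrec.fst)) Primrec.snd)
  have hsucc : Primrec fun q : (ℕ × ℕ) × ℕ => q.2 + 1 := Primrec.succ.comp Primrec.snd
  have hdata : Computable fun q : (ℕ × ℕ) × ℕ => Primcodable.toEncodable.encode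
      ((Finset.range (q.2 + 1)).image (triple q.1.1 q.1.2), q.2 + 1) :=
    (Primrec.encode.comp ((primrec_image_range htriple hsucc
      fun q => strictMono_triple _ _).pair hsucc)).to_comp
  let g : (ℕ × ℕ) × ℕ →. ℕ := fun q =>
    ((Denumerable.ofNat Code q.1.1).eval (Primcodable.toEncodable.encode
      ((Finset.range (q.2 + 1)).image (triple q.1.1 q.1.2), q.2 + 1))).bind fun e =>
        (Denumerable.ofNat Code e).eval (triple q.1.1 q.1.2 (q.2 + 1))
  have hg : Partrec g :=
    (Code.eval_part.comp ((Computable.ofNat Code).comp (Computable.fst.comp Computable.fst))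
      hdata).bind (Code.eval_part.comp ((Computable.ofNat Code).comp Computable.snd)
        ((htriple.comp Primrec.id hsucc).to_comp.comp Computable.fst)).to₂
  obtain ⟨f, hf, hdom, hsound⟩ := exists_partrec_selector hg
  refine ⟨fun p => (f p).map Nat.succ, hf.map (Computable.succ.comp Computable.snd).to₂,
    fun p v hv => ?_, fun h hh => ?_⟩
  · obtain ⟨n, -, rfl⟩ := (Part.mem_map_iff _).1 hv
    exact Nat.succ_pos n
  · obtain ⟨c, hc⟩ := exists_code_eval_encode hh
    have hgdom (j n : ℕ) :
        (g ((Encodable.encode c, j), n)).Dom ↔ Overgeneralizes h (Encodable.encode c) j (n + 1) := by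
      simp only [g, Denumerable.ofNat_encode, hc, Overgeneralizes, Part.dom_iff_mem,
        Part.mem_bind_iff, Wset, Set.mem_ofPred_eq]
      exact ⟨fun ⟨y, e, he, hy⟩ => ⟨e, he, y, hy⟩, fun ⟨e, he, y, hy⟩ => ⟨y, e, he, hy⟩⟩
    refine ⟨Encodable.encode c, fun j => ⟨?_, fun v hv => ?_⟩⟩
    · rintro ⟨_ | n, hv, ho⟩
      · exact absurd hv (lt_irrefl 0)
      · exact hdom _ n ((hgdom j n).2 ho)
    · obtain ⟨n, hn, rfl⟩ := (Part.mem_map_iff _).1 hv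
      exact (hgdom j n).1 (hsound _ n hn)

/-- The elements of the first `k` cut blocks, enumerated block by block. -/
def cutList (c : ℕ) (f : ℕ → ℕ) (k : ℕ) : List ℕ :=
  (List.range k).flatMap fun j => (List.range (f j)).map (triple c j)

theorem cutList_succ (c : ℕ) (f : ℕ → ℕ) (k : ℕ) :
    cutList c f (k + 1) = cutList c f k ++ (List.range (f k)).map (triple c k) := by
  simp [cutList, List.range_succ]

theorem prefix_cutList (c : ℕ) (f : ℕ → ℕ) {m n : ℕ} (h : m ≤ n) :
    cutList c f m <+: cutList c f n := by
  induction n, h using Nat.le_induction with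
  | base => exact List.prefix_rfl
  | succ n _ ih => exact ih.trans (cutList_succ c f n ▸ List.prefix_append _ _)

theorem le_length_cutList (c : ℕ) {f : ℕ → ℕ} (hpos : ∀ j, 0 < f j) (k : ℕ) :
    k ≤ (cutList c f k).length := by
  induction k with
  | zero => exact Nat.zero_le _
  | succ k ih =>
    have := hpos k
    simp only [cutList_succ, List.length_append, List.length_map, List.length_range]
    omega

theorem mem_cutList {c : ℕ} {f : ℕ → ℕ} {k x : ℕ} :
    x ∈ cutList c f k ↔
      learnerTag x = c ∧ blockIndex x < k ∧ position x < f (blockIndex x) := by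
  simp only [cutList, List.mem_flatMap, List.mem_range, List.mem_map]
  constructor
  · rintro ⟨j, hj, i, hi, rfl⟩
    simpa using ⟨hj, hi⟩
  · rintro ⟨rfl, hk, hp⟩
    exact ⟨_, hk, _, hp, triple_eta x⟩

theorem List.IsPrefix.getElem?_eq_of_lt {α : Type*} {l l' : List α} (h : l <+: l') {n : ℕ}
    (hn : n < l.length) : l'[n]? = l[n]? := by
  obtain ⟨t, rfl⟩ := h
  exact List.getElem?_append_left hn

theorem mem_fset {T : Text} {n x : ℕ} : x ∈ fset T n ↔ ∃ i < n, T i = some x :=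
  List.mem_toFinset.trans mem_reduceOption_seg

theorem fset_length_eq_toFinset {T : Text} {l : List ℕ} (h : ∀ i < l.length, T i = l[i]?) :
    fset T l.length = l.toFinset := by
  ext x
  rw [mem_fset, List.mem_toFinset, List.mem_iff_getElem?]
  constructor
  · rintro ⟨i, hi, hx⟩
    exact ⟨i, (h i hi).symm.trans hx⟩
  · rintro ⟨i, hx⟩
    have hi : i < l.length := (List.getElem?_eq_some_iff.1 hx).1
    exact ⟨i, hi, (h i hi).trans hx⟩

/-- The text enumerating the elements of a list, followed by pauses. -/
def listText (l : List ℕ) : Text := fun n => l[n]?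

theorem content_listText (l : List ℕ) : content (listText l) = {x | x ∈ l} := by
  ext x
  exact List.mem_iff_getElem?.symm

theorem fset_listText {l l' : List ℕ} (h : l <+: l') :
    fset (listText l') l.length = l.toFinset :=
  fset_length_eq_toFinset fun _ hi => h.getElem?_eq_of_lt hi

/-- The text enumerating all cut blocks, block by block. -/
def cutText (c : ℕ) (f : ℕ → ℕ) : Text := fun n => (cutList c f (n + 1))[n]?

theorem cutText_eq {c : ℕ} {f : ℕ → ℕ} (hpos : ∀ j, 0 < f j) {k i : ℕ}
    (hi : i < (cutList c f k).length) : cutText c f i = (cutList c f k)[i]? := by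
  rcases le_total (i + 1) k with h | h
  · exact ((prefix_cutList c f h).getElem?_eq_of_lt (le_length_cutList c hpos (i + 1))).symm
  · exact (prefix_cutList c f h).getElem?_eq_of_lt hi

theorem mem_content_cutText {c : ℕ} {f : ℕ → ℕ} (hpos : ∀ j, 0 < f j) {x : ℕ} :
    x ∈ content (cutText c f) ↔ learnerTag x = c ∧ position x < f (blockIndex x) := by
  constructor
  · rintro ⟨n, hn⟩
    obtain ⟨h₁, -, h₂⟩ := mem_cutList.1 (List.mem_of_getElem? hn)
    exact ⟨h₁, h₂⟩
  · rintro ⟨h₁, h₂⟩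
    have hx : x ∈ cutList c f (blockIndex x + 1) := mem_cutList.2 ⟨h₁, Nat.lt_succ_self _, h₂⟩
    obtain ⟨i, hi⟩ := List.mem_iff_getElem?.1 hx
    exact ⟨i, (cutText_eq hpos (List.getElem?_eq_some_iff.1 hi).1).trans hi⟩

theorem exists_overgeneralizes {h : Finset ℕ × ℕ →. ℕ} {c j : ℕ}
    (hBc : ∀ T : Text, content T = fullBlock c j →
      ∃ n₀ : ℕ, ∀ n ≥ n₀, ∃ e ∈ h (fset T n, n), Wset e = fullBlock c j) :
    ∃ v > 0, Overgeneralizes h c j v := by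
  let T : Text := fun n => some (triple c j n)
  have hT : content T = fullBlock c j := by
    ext x
    rw [mem_fullBlock]
    constructor
    · rintro ⟨n, hn⟩
      obtain rfl := Option.some.inj hn
      simp
    · rintro ⟨rfl, rfl⟩
      exact ⟨position x, congrArg some (triple_eta x)⟩
  have hfset (n : ℕ) : fset T n = (Finset.range n).image (triple c j) := by
    ext x
    rw [mem_fset]
    simp [T]
  obtain ⟨n₀, hn₀⟩ := hBc T hT
  obtain ⟨e, he, hW⟩ := hn₀ (n₀ + 1) (Nat.le_succ _)
  exact ⟨n₀ + 1, Nat.succ_pos _, e, hfset _ ▸ he, hW ▸ mem_fullBlock.2 (by simp)⟩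

theorem blockClass_not_mem_TxtPsdMonBc {F : ℕ × ℕ →. ℕ} (hpos : ∀ p, ∀ v ∈ F p, 0 < v)
    (hF : ∀ h : Finset ℕ × ℕ →. ℕ, Partrec h → ∃ c, ∀ j,
      ((∃ v > 0, Overgeneralizes h c j v) → (F (c, j)).Dom) ∧
        ∀ v ∈ F (c, j), Overgeneralizes h c j v) :
    blockClass F ∉ TxtPsdMonBc := by
  rintro ⟨h, hh, hlearn⟩
  obtain ⟨c, hc⟩ := hF h hh
  have htot (j : ℕ) : (F (c, j)).Dom :=
    (hc j).1 (exists_overgeneralizes fun T hT => (hlearn _ (Or.inl ⟨c, j, rfl⟩) T hT).1)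
  obtain ⟨f, hf⟩ : ∃ f : ℕ → ℕ, ∀ j, F (c, j) = Part.some (f j) :=
    ⟨fun j => (F (c, j)).get (htot j), fun j => (Part.some_get _).symm⟩
  have hmem (j : ℕ) : f j ∈ F (c, j) := hf j ▸ Part.mem_some _
  have hfpos (j : ℕ) : 0 < f j := hpos _ _ (hmem j)
  have hcut : content (cutText c f) = cutBlocks F c := by
    ext x
    rw [mem_content_cutText hfpos, mem_cutBlocks hf]
  obtain ⟨n₀, hn₀⟩ := (hlearn _ (Or.inr ⟨c, htot, Or.inl rfl⟩) _ hcut).1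
  let k := n₀ + 1
  let B := (List.range (f k)).map (triple c k)
  let m := triple c k (f k)
  let T := listText (B ++ cutList c f k ++ [m])
  have hT : content T = markedBlocks F c k := by
    ext x
    have hB : x ∈ B ↔ learnerTag x = c ∧ blockIndex x = k ∧ position x < f k := by
      simp only [B, List.mem_map, List.mem_range]
      constructor
      · rintro ⟨i, hi, rfl⟩
        simpa using hi
      · rintro ⟨rfl, hk, hi⟩
        exact ⟨_, hi, hk ▸ triple_eta x⟩
    have hm : x = m ↔ learnerTag x = c ∧ blockIndex x = k ∧ position x = f k := by
      constructor
      · rintro rfl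
        simp [m]
      · rintro ⟨h₁, h₂, h₃⟩
        rw [← triple_eta x, h₁, h₂, h₃]
    rw [content_listText, mem_markedBlocks hf, Set.mem_ofPred_eq]
    simp only [List.mem_append, List.mem_singleton, hB, hm, mem_cutList]
    have hfx : blockIndex x = k → f (blockIndex x) = f k := congrArg f
    grind
  have hlen : (B ++ cutList c f k).length = (cutList c f (k + 1)).length := by
    rw [cutList_succ c f k, List.length_append, List.length_append, add_comm]
  have hdata : fset T (cutList c f (k + 1)).length =
      fset (cutText c f) (cutList c f (k + 1)).length := by
    rw [fset_length_eq_toFinset fun i hi => cutText_eq hfpos hi, ← hlen,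
      fset_listText (List.prefix_append _ _), cutList_succ c f k, List.toFinset_append,
      List.toFinset_append, Finset.union_comm]
  obtain ⟨e, he, hme⟩ := (hc k).2 _ (hmem k)
  have hstart : fset T (f k) = (Finset.range (f k)).image (triple c k) := by
    have := fset_listText (l := B) (l' := B ++ cutList c f k ++ [m])
      (List.append_assoc _ _ _ ▸ List.prefix_append _ _)
    rw [show B.length = f k by simp [B]] at this
    refine this.trans ?_
    ext x
    simp [B]
  obtain ⟨e', he', hW⟩ := hn₀ (cutList c f (k + 1)).length
    ((show n₀ ≤ k + 1 by omega).trans (le_length_cutList c hfpos (k + 1)))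
  have hmon := (hlearn _ (Or.inr ⟨c, htot, Or.inr ⟨k, Nat.succ_pos _, rfl⟩⟩) T hT).2 (f k)
    (cutList c f (k + 1)).length (by rw [← hlen]; simp [B]) e (hstart ▸ he) e' (hdata ▸ he')
  have hmT : m ∈ content T := hT ▸ (mem_markedBlocks hf).2 (by simp [m])
  have := (hmon ⟨hme, hmT⟩).1
  rw [hW, mem_cutBlocks hf] at this
  simp at this

/-- [TxtGMonEx] \ [TxtPsdMonBc] ≠ ∅. -/
theorem TxtGMonEx_not_sub_TxtPsdMonBc :
    ∃ 𝓛 : Set (Set ℕ), 𝓛 ∈ TxtGMonEx ∧ 𝓛 ∉ TxtPsdMonBc := by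
  obtain ⟨F, hF, hpos, hdiag⟩ := exists_partrec_overgeneralization
  exact ⟨blockClass F, blockClass_mem_TxtGMonEx hF hpos,
    blockClass_not_mem_TxtPsdMonBc hpos hdiag⟩
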